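/- arXiv:1708.07921 — 3 statements merged into one kernel-verified Lean document; each statement's English description precedes it below -/
import Mathlib

section
/- For every natural number n ≥ 1, the ordered configuration space PConf_n(ℝ²) is aspherical: for every integer m ≥ 2 and every basepoint x ∈ PConf_n(ℝ²), the m-th homotopy group π_m(PConf_n(ℝ²), x) is trivial. -/
open scoped Topology

/-- The ordered configuration space of `n` points in `S`. -/
abbrev PConf (n : ℕ) (S : Type*) : Type _ := {x : Fin n → S // Function.Injective x}

open scoped unitInterval

theorem homotopicRel_const_of_tree {K E A : Type*} [TopologicalSpace K] [NormalSpace K]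
    [PreconnectedSpace K] [TopologicalSpace E] [AddCommGroup E] [Module ℝ E]
    [IsTopologicalAddGroup E] [ContinuousSMul ℝ E] {X : Set E} {B : Set K} (hB : B.Nonempty)
    (depth : A → ℕ) (parent : A → A) (hdepth : ∀ a, 0 < depth a → depth (parent a) < depth a)
    (U : A → Set E) (hUX : ∀ a, U a ⊆ X) (hUc : ∀ a, Convex ℝ (U a))
    (hUp : ∀ a, 0 < depth a → (U a).Nonempty → (U a ∩ U (parent a)).Nonempty)
    (a₀ : A) (ha₀ : depth a₀ = 0) (x : X) (T : Finset A) (ha₀T : a₀ ∈ T)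
    (hT : ∀ a ∈ T, 0 < depth a → parent a ∈ T) (V : A → Set K) (f : C(K, X))
    (hfB : ∀ k ∈ B, f k = x) (hVo : ∀ a ∈ T, IsOpen (V a)) (hVc : ∀ k, ∃ a ∈ T, k ∈ V a)
    (hVU : ∀ a ∈ T, ∀ k ∈ V a, (f k : E) ∈ U a) (hB₀ : B ⊆ V a₀)
    (hVB : ∀ a ∈ T, a ≠ a₀ → Disjoint (V a) B)
    (hVV : ∀ a ∈ T, ∀ b ∈ T, ∀ k ∈ V a, k ∈ V b → a = b ∨
      (0 < depth a ∧ parent a = b) ∨ (0 < depth b ∧ parent b = a)) :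
    f.HomotopicRel (ContinuousMap.const K x) B := by
  classical
  induction hn : T.card using Nat.strong_induction_on generalizing T V f with
  | _ n ih =>
  by_cases hpos : ∃ a ∈ T, 0 < depth a
  · -- collapse a vertex of maximal depth into its parent
    obtain ⟨a, haT, hamax⟩ := Finset.exists_max_image T depth ⟨a₀, ha₀T⟩
    have ha : 0 < depth a := by
      obtain ⟨b, hb, hb'⟩ := hpos
      exact hb'.trans_le (hamax b hb)
    have haa₀ : a₀ ≠ a := by rintro rfl; omega
    have hpa : parent a ≠ a := fun h ↦ by have := hdepth a ha; rw [h] at this; omega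
    have hleaf : ∀ b ∈ T, b ≠ a → ∀ k ∈ V a, k ∈ V b → parent a = b := by
      intro b hb hba k hka hkb
      rcases hVV a haT b hb k hka hkb with h | h | h
      · exact absurd h.symm hba
      · exact h.2
      · have := hdepth b h.1
        have := hamax b hb
        rw [h.2] at *
        omega
    have hT' : ∀ b ∈ T.erase a, 0 < depth b → parent b ∈ T.erase a := by
      intro b hb hb0
      rw [Finset.mem_erase] at hb ⊢
      refine ⟨fun h ↦ ?_, hT b hb.2 hb0⟩
      have := hdepth b hb0
      have := hamax b hb.2
      rw [h] at *
      omega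
    have hcard : (T.erase a).card < n := hn ▸ Finset.card_erase_lt_of_mem haT
    have ha₀T' : a₀ ∈ T.erase a := Finset.mem_erase.2 ⟨haa₀, ha₀T⟩
    rcases (V a).eq_empty_or_nonempty with hVa | ⟨k₀, hk₀⟩
    · refine ih _ hcard _ ha₀T' hT' V f hfB (fun b hb ↦ hVo b (Finset.mem_of_mem_erase hb))
        (fun k ↦ ?_) (fun b hb ↦ hVU b (Finset.mem_of_mem_erase hb)) hB₀
        (fun b hb ↦ hVB b (Finset.mem_of_mem_erase hb))
        (fun b hb c hc ↦ hVV b (Finset.mem_of_mem_erase hb) c (Finset.mem_of_mem_erase hc)) rfl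
      obtain ⟨b, hb, hk⟩ := hVc k
      refine ⟨b, Finset.mem_erase.2 ⟨?_, hb⟩, hk⟩
      rintro rfl
      simp [hVa] at hk
    · obtain ⟨p, hp, hp'⟩ := hUp a ha ⟨_, hVU a haT k₀ hk₀⟩
      obtain ⟨χ, hχ0, hχ1, hχ⟩ := exists_continuous_zero_one_of_isClosed
        (s := (V a)ᶜ) (t := (⋃ b ∈ T.erase a, V b)ᶜ) (hVo a haT).isClosed_compl
        (isOpen_biUnion fun b hb ↦ hVo b (Finset.mem_of_mem_erase hb)).isClosed_compl
        (by
          rw [Set.disjoint_compl_left_iff_subset]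
          intro k hk
          obtain ⟨b, hb, hkb⟩ := hVc k
          by_contra hka
          refine hk (Set.mem_biUnion (x := b) (Finset.mem_erase.2 ⟨?_, hb⟩) hkb)
          rintro rfl
          exact hka hkb)
      have hseg : ∀ (s : ℝ) (_ : s ∈ Set.Icc (0 : ℝ) 1) (W : Set E) (_ : Convex ℝ W) (y : E),
          y ∈ W → p ∈ W → (1 - s) • y + s • p ∈ W := fun s hs W hW y hy hpW ↦
        hW hy hpW (by linarith [hs.2]) hs.1 (by ring)
      have hmem : ∀ (t : I) (k : K), (1 - t * χ k) • (f k : E) + (t * χ k : ℝ) • p ∈ X := by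
        intro t k
        by_cases hk : k ∈ V a
        · exact hUX a (hseg _ ⟨mul_nonneg t.2.1 (hχ k).1, mul_le_one₀ t.2.2 (hχ k).1 (hχ k).2⟩ _
            (hUc a) _ (hVU a haT k hk) hp)
        · simp [hχ0 hk]
      let F : C(I × K, X) := ⟨fun z ↦ ⟨_, hmem z.1 z.2⟩, by fun_prop⟩
      let f' : C(K, X) := ⟨fun k ↦ F (1, k), by fun_prop⟩
      have hf'  : ∀ k, (f' k : E) = (1 - χ k) • (f k : E) + χ k • p := fun k ↦ by simp [f', F]
      have hf'V : ∀ k ∉ V a, f' k = f k := fun k hk ↦ by ext; rw [hf' k, hχ0 hk]; simp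
      have hBa : ∀ k ∈ B, k ∉ V a := fun k hk hka ↦
        (Set.disjoint_left.1 (hVB a haT haa₀.symm)) hka hk
      refine ContinuousMap.HomotopicRel.trans (g := f')
        ⟨⟨⟨F, fun k ↦ ?_, fun k ↦ rfl⟩, fun t k hk ↦ ?_⟩⟩ ?_
      · ext; simp [F]
      · ext
        have := hχ0 (hBa k hk)
        simp [F, this]
      refine ih _ hcard _ ha₀T' hT' (Function.update V (parent a) (V (parent a) ∪ V a)) f'
        (fun k hk ↦ by rw [hf'V k (hBa k hk), hfB k hk]) ?_ ?_ ?_ ?_ ?_ ?_ rfl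
      · intro b hb
        have := hVo b (Finset.mem_of_mem_erase hb)
        rcases eq_or_ne b (parent a) with rfl | h
        · simpa using this.union (hVo a haT)
        · simpa [h] using this
      · intro k
        by_cases hk : k ∈ V a
        · exact ⟨parent a, Finset.mem_erase.2 ⟨hpa, hT a haT ha⟩, by simp [hk]⟩
        · obtain ⟨b, hb, hkb⟩ := hVc k
          refine ⟨b, Finset.mem_erase.2 ⟨?_, hb⟩, ?_⟩
          · rintro rfl; exact hk hkb
          · rcases eq_or_ne b (parent a) with rfl | h
            · simp [hkb]
            · simpa [h] using hkb
      · intro b hb k hk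
        rw [Finset.mem_erase] at hb
        rcases eq_or_ne b (parent a) with rfl | h
        · by_cases hkp : k ∈ V (parent a)
          · rw [hf' k]
            exact hseg _ (hχ k) _ (hUc _) _ (hVU _ hb.2 k hkp) hp'
          · have hka : k ∈ V a := by simpa [hkp] using hk
            have : χ k = 1 := hχ1 (by
              simp only [Set.mem_compl_iff, Set.mem_iUnion, not_exists]
              intro b hb hkb
              rw [Finset.mem_erase] at hb
              exact hkp (hleaf b hb.2 hb.1 k hka hkb ▸ hkb))
            rw [hf' k, this]
            simpa using hp'
        · have hkb : k ∈ V b := by simpa [h] using hk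
          rw [hf'V k fun hka ↦ h (hleaf b hb.2 hb.1 k hka hkb).symm]
          exact hVU b hb.2 k hkb
      · rcases eq_or_ne a₀ (parent a) with h | h
        · rw [h, Function.update_self, ← h]
          exact hB₀.trans Set.subset_union_left
        · simpa [h] using hB₀
      · intro b hb hb₀
        rw [Finset.mem_erase] at hb
        rcases eq_or_ne b (parent a) with rfl | h
        · simpa using ⟨hVB _ hb.2 hb₀, hVB a haT haa₀.symm⟩
        · simpa [h] using hVB b hb.2 hb₀
      · have key : ∀ b ∈ T.erase a, ∀ k ∈ Function.update V (parent a) (V (parent a) ∪ V a) b,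
            k ∈ V b ∨ (b = parent a ∧ k ∈ V a) := by
          intro b hb k hk
          rcases eq_or_ne b (parent a) with rfl | h
          · simpa using hk
          · exact Or.inl (by simpa [h] using hk)
        intro b hb c hc k hkb hkc
        have hb' := Finset.mem_erase.1 hb
        have hc' := Finset.mem_erase.1 hc
        rcases key b hb k hkb with h | ⟨h, h'⟩ <;> rcases key c hc k hkc with i | ⟨i, i'⟩
        · exact hVV b hb'.2 c hc'.2 k h i
        · exact Or.inl ((hleaf b hb'.2 hb'.1 k i' h).symm.trans i.symm)
        · exact Or.inl (h.trans (hleaf c hc'.2 hc'.1 k h' i))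
        · exact Or.inl (h.trans i.symm)
  · push Not at hpos
    have huniv : V a₀ = Set.univ := by
      refine IsClopen.eq_univ ⟨?_, hVo a₀ ha₀T⟩ (hB.mono hB₀)
      have : V a₀ = (⋃ b ∈ T.erase a₀, V b)ᶜ := by
        ext k
        simp only [Set.mem_compl_iff, Set.mem_iUnion, not_exists, Finset.mem_erase]
        constructor
        · rintro hk b ⟨hb, hbT⟩ hkb
          rcases hVV b hbT a₀ ha₀T k hkb hk with h | h | h
          · exact hb h
          · have := hpos b hbT; omega
          · omega
        · intro h
          obtain ⟨b, hb, hkb⟩ := hVc k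
          by_cases hba : b = a₀
          · exact hba ▸ hkb
          · exact absurd hkb (h b ⟨hba, hb⟩)
      rw [this]
      exact (isOpen_biUnion fun b hb ↦ hVo b (Finset.mem_of_mem_erase hb)).isClosed_compl
    have hU : ∀ k, (f k : E) ∈ U a₀ := fun k ↦ hVU a₀ ha₀T k (huniv ▸ Set.mem_univ k)
    obtain ⟨k₀, hk₀⟩ := hB
    have hx : (x : E) ∈ U a₀ := hfB k₀ hk₀ ▸ hU k₀
    have hmem : ∀ (t : I) (k : K), (1 - t : ℝ) • (f k : E) + (t : ℝ) • (x : E) ∈ X := fun t k ↦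
      hUX a₀ (hUc a₀ (hU k) hx (by linarith [t.2.2]) t.2.1 (by ring))
    let F : C(I × K, X) := ⟨fun z ↦ ⟨_, hmem z.1 z.2⟩, by fun_prop⟩
    refine ⟨⟨⟨F, fun k ↦ ?_, fun k ↦ ?_⟩, fun t k hk ↦ ?_⟩⟩
    · ext; simp [F]
    · ext; simp [F]
    · ext
      have := hfB k hk
      simp [F, this, ← add_smul]

/-- Words without two equal consecutive letters. -/
def ReducedWord (L : Type*) : Type _ := {l : List L // l.IsChain (· ≠ ·)}

namespace ReducedWord

variable {L : Type*}

instance : TopologicalSpace (ReducedWord L) := ⊥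

instance : DiscreteTopology (ReducedWord L) := ⟨rfl⟩

/-- The empty word. -/
def nil : ReducedWord L := ⟨[], by simp⟩

/-- The length of a word. -/
def length (w : ReducedWord L) : ℕ := w.1.length

open Classical in
/-- Remove the first letter of a word if it is `j`, and prepend `j` otherwise. -/
noncomputable def flip (j : L) (w : ReducedWord L) : ReducedWord L :=
  if h : w.1.head? = some j then ⟨w.1.tail, w.2.tail⟩
  else ⟨j :: w.1, List.isChain_cons.2 ⟨fun _ hy hj ↦ h (hj ▸ hy), w.2⟩⟩

theorem flip_flip (j : L) (w : ReducedWord L) : flip j (flip j w) = w := by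
  obtain ⟨w, hw⟩ := w
  cases w with
  | nil => simp [flip]; rfl
  | cons a t =>
    by_cases h : a = j
    · subst h
      have : ¬ t.head? = some a := fun h ↦ (List.isChain_cons.1 hw).1 a h rfl
      simp [flip, this]; rfl
    · simp [flip, h]; rfl

theorem length_flip_of_head {j : L} {w : ReducedWord L} (h : w.1.head? = some j) :
    (flip j w).length + 1 = w.length := by
  obtain ⟨w, hw⟩ := w
  cases w with
  | nil => simp at h
  | cons a t => simp_all [flip, length]

theorem length_flip_of_ne_head {j : L} {w : ReducedWord L} (h : w.1.head? ≠ some j) :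
    (flip j w).length = w.length + 1 := by
  simp [flip, h, length]

end ReducedWord

/-- Two open sets covering a simply connected space, together with a locally constant letter on
their intersection, determine a compatible pair of locally constant labellings by reduced words. -/
theorem exists_reducedWord_labelling {K L : Type*} [TopologicalSpace K] [SimplyConnectedSpace K]
    [LocallyPathConnectedSpace K] {P N : Set K} (hP : IsOpen P) (hN : IsOpen N)
    (hPN : P ∪ N = Set.univ) (g : K → L) (hg : ∀ k ∈ P ∩ N, ∀ᶠ k' in 𝓝 k, g k' = g k)
    {k₀ : K} (hk₀ : k₀ ∈ N) :
    ∃ u v : K → ReducedWord L, ContinuousOn u P ∧ ContinuousOn v N ∧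
      (∀ k ∈ P ∩ N, u k = (v k).flip (g k)) ∧ v k₀ = .nil := by
  classical
  let Z : FiberBundleCore Bool K (ReducedWord L) :=
    { baseSet := fun b ↦ if b then P else N
      isOpen_baseSet := by rintro (_ | _) <;> simpa
      indexAt := fun k ↦ decide (k ∈ P)
      mem_baseSet_at := by
        intro k
        by_cases h : k ∈ P
        · simp [h]
        · simpa [h] using hPN.ge (Set.mem_univ k)
      coordChange := fun i j k w ↦ if i = j then w else w.flip (g k)
      coordChange_self := by simp
      continuousOn_coordChange := by
        intro i j
        by_cases h : i = j
        · simpa [h] using continuousOn_snd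
        · simp only [h, if_false]
          rintro ⟨k, w⟩ ⟨hk, -⟩
          have hk' : k ∈ P ∩ N := by
            cases i <;> cases j <;> simp_all
          refine ContinuousAt.continuousWithinAt (ContinuousAt.congr
            (continuousAt_const (y := w.flip (g k))) ?_)
          have h1 : ∀ᶠ z : K × ReducedWord L in 𝓝 (k, w), g z.1 = g k :=
            (continuous_fst.tendsto (k, w)).eventually (hg k hk')
          have h2 : ∀ᶠ z : K × ReducedWord L in 𝓝 (k, w), z.2 = w :=
            (continuous_snd.tendsto (k, w)).eventually ((isOpen_discrete {w}).mem_nhds rfl)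
          filter_upwards [h1, h2] with z h1 h2
          rw [h1, h2]
      coordChange_comp := by
        intro i j k x _ w
        cases i <;> cases j <;> cases k <;> simp [ReducedWord.flip_flip] }
  have hcov : IsCoveringMap Z.proj := by
    refine IsFiberBundle.isCoveringMap (F := ReducedWord L) fun k ↦ ?_
    exact ⟨Z.localTrivAt k, Z.mem_localTrivAt_baseSet k⟩
  have hsurj : ∃ e : Z.TotalSpace, Z.proj e = k₀ ∧ (Z.localTriv false e).2 = .nil := by
    refine ⟨(Z.localTriv false).invFun (k₀, .nil), ?_, ?_⟩
    · exact (Z.localTriv false).proj_symm_apply' hk₀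
    · exact congrArg Prod.snd ((Z.localTriv false).apply_symm_apply' hk₀)
  obtain ⟨e, he, he'⟩ := hsurj
  obtain ⟨s, ⟨hs₀, hs⟩, -⟩ := hcov.existsUnique_continuousMap_lifts (ContinuousMap.id K) k₀ e he
  have hs' : ∀ k, Z.proj (s k) = k := fun k ↦ congrFun hs k
  have hcont : ∀ b, ContinuousOn (fun k ↦ (Z.localTriv b (s k)).2) (Z.baseSet b) := by
    intro b
    refine continuous_snd.comp_continuousOn
      ((Z.localTriv b).continuousOn.comp s.continuous.continuousOn fun k hk ↦ ?_)
    rw [(Z.localTriv b).source_eq, Set.mem_preimage, hs']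
    exact hk
  refine ⟨fun k ↦ (Z.localTriv true (s k)).2, fun k ↦ (Z.localTriv false (s k)).2,
    hcont true, hcont false, fun k hk ↦ ?_, by simpa [hs₀] using he'⟩
  have h1 : (s k).1 = k := hs' k
  simp only [FiberBundleCore.localTriv_apply, h1]
  have := Z.coordChange_comp (Z.indexAt k) false true k
    ⟨⟨Z.mem_baseSet_at k, hk.2⟩, hk.1⟩ (s k).2
  rw [← this]
  simp [Z]

/-- A finite set of reals cuts the line into finitely many open intervals. -/
theorem exists_gap_labelling (S : Finset ℝ) : ∃ (L : Type) (γ : ℝ → L),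
    (∀ j, ∃ x ∉ S, γ x = j) ∧ (∀ j, Set.OrdConnected {x | x ∉ S ∧ γ x = j}) ∧
      ∀ x ∉ S, ∀ᶠ y in 𝓝 x, γ y = γ x := by
  classical
  let L := {j : Finset ℝ // ∃ x ∉ S, S.filter (· < x) = j}
  obtain ⟨x₀, hx₀⟩ := Infinite.exists_notMem_finset S
  let γ : ℝ → L := fun x ↦ if h : x ∉ S then ⟨S.filter (· < x), x, h, rfl⟩ else ⟨_, x₀, hx₀, rfl⟩
  have hγ : ∀ x (h : x ∉ S), γ x = ⟨S.filter (· < x), x, h, rfl⟩ := fun x h ↦ dif_pos h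
  refine ⟨L, γ, ?_, ?_, ?_⟩
  · rintro ⟨j, x, hx, rfl⟩
    exact ⟨x, hx, hγ x hx⟩
  · intro j
    refine ⟨fun x hx y hy z hz ↦ ?_⟩
    have hxy : S.filter (· < x) = S.filter (· < y) := by
      have := hx.2.trans hy.2.symm
      rw [hγ x hx.1, hγ y hy.1] at this
      exact congrArg Subtype.val this
    have hq : ∀ q ∈ S, q < y → q < x := fun q hq hqy ↦ by
      have : q ∈ S.filter (· < x) := hxy ▸ Finset.mem_filter.2 ⟨hq, hqy⟩
      exact (Finset.mem_filter.1 this).2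
    have hzS : z ∉ S := fun h ↦ by
      rcases hz.2.lt_or_eq with h' | rfl
      · exact (hq z h h').not_ge hz.1
      · exact hy.1 h
    refine ⟨hzS, ?_⟩
    rw [← hx.2, hγ x hx.1, hγ z hzS]
    refine Subtype.ext (Finset.filter_congr fun q hqS ↦
      ⟨fun h ↦ hq q hqS (h.trans_le hz.2), fun h ↦ h.trans_le hz.1⟩)
  · intro x hx
    have h1 : ∀ᶠ y in 𝓝 x, ∀ q ∈ S, q ≠ y ∧ (q < y ↔ q < x) := by
      rw [Filter.eventually_all_finset]
      intro q hq
      rcases lt_or_gt_of_ne (fun h : q = x ↦ hx (h ▸ hq)) with h | h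
      · filter_upwards [lt_mem_nhds h] with y hy
        exact ⟨hy.ne, iff_of_true hy h⟩
      · filter_upwards [gt_mem_nhds h] with y hy
        exact ⟨hy.ne', iff_of_false hy.not_gt h.not_gt⟩
    filter_upwards [h1] with y hy
    have hyS : y ∉ S := fun h ↦ (hy y h).1 rfl
    rw [hγ x hx, hγ y hyS]
    exact Subtype.ext (Finset.filter_congr fun q hqS ↦ (hy q hqS).2)

/-- Vertices of the tree of half-planes and vertical strips which covers the universal cover of
a plane punctured at finitely many points of the horizontal axis. -/
inductive PlanePiece (L : Type*)
  | upper (w : ReducedWord L)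
  | lower (w : ReducedWord L)
  | gap (j : L) (w : ReducedWord L)

namespace PlanePiece

variable {L : Type*}

/-- The distance of a piece to the nearest root. -/
noncomputable def depth : PlanePiece L → ℕ
  | upper w => 2 * w.length
  | lower w => 2 * w.length
  | gap j w => 2 * min w.length (w.flip j).length + 1

/-- The neighbour of a piece in the direction of the root. -/
noncomputable def parent : PlanePiece L → PlanePiece L
  | upper w => w.1.head?.elim (upper w) fun j ↦ gap j (w.flip j)
  | lower w => w.1.head?.elim (lower w) fun j ↦ gap j w
  | gap j w => if w.length < (w.flip j).length then lower w else upper (w.flip j)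

/-- Two pieces are adjacent when one of them is the parent of the other. -/
def Adj (a b : PlanePiece L) : Prop :=
  (0 < a.depth ∧ a.parent = b) ∨ (0 < b.depth ∧ b.parent = a)

theorem Adj.symm {a b : PlanePiece L} (h : Adj a b) : Adj b a := Or.symm h

theorem adj_lower_gap (j : L) (w : ReducedWord L) : Adj (lower w) (gap j w) := by
  by_cases h : w.1.head? = some j
  · have := ReducedWord.length_flip_of_head h
    exact Or.inl ⟨by simp only [depth]; omega, by simp [parent, h]⟩
  · have := ReducedWord.length_flip_of_ne_head h
    exact Or.inr ⟨by simp [depth], by simp [parent, this]⟩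

theorem adj_upper_gap (j : L) (w : ReducedWord L) : Adj (upper (w.flip j)) (gap j w) := by
  by_cases h : (w.flip j).1.head? = some j
  · have := ReducedWord.length_flip_of_head h
    exact Or.inl ⟨by simp only [depth]; omega, by simp [parent, h, ReducedWord.flip_flip]⟩
  · have := ReducedWord.length_flip_of_ne_head h
    rw [ReducedWord.flip_flip] at this
    exact Or.inr ⟨by simp [depth], by simp [parent, this]⟩

theorem depth_parent_lt (a : PlanePiece L) (ha : 0 < a.depth) : a.parent.depth < a.depth := by
  cases a with
  | upper w =>
    cases h : w.1.head? with
    | none => simp_all [depth, ReducedWord.length]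
    | some j =>
      have := ReducedWord.length_flip_of_head h
      simp only [parent, h, depth, Option.elim, ReducedWord.flip_flip]
      omega
  | lower w =>
    cases h : w.1.head? with
    | none => simp_all [depth, ReducedWord.length]
    | some j =>
      have := ReducedWord.length_flip_of_head h
      simp only [parent, h, depth, Option.elim]
      omega
  | gap j w =>
    by_cases h : w.length < (w.flip j).length
    · simp only [parent, h, depth, if_true]; omega
    · simp only [parent, h, depth, if_false]; omega

/-- The part of the plane represented by a piece. -/
def region (S : Finset ℝ) (γ : ℝ → L) : PlanePiece L → Set (ℝ × ℝ)
  | upper _ => {p | 0 < p.2}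
  | lower _ => {p | p.2 < 0}
  | gap j _ => {p | p.1 ∉ S ∧ γ p.1 = j}

theorem convex_region (S : Finset ℝ) (γ : ℝ → L)
    (hγ : ∀ j, Set.OrdConnected {x | x ∉ S ∧ γ x = j}) (a : PlanePiece L) :
    Convex ℝ (a.region S γ) := by
  cases a with
  | upper w => exact (convex_Ioi (0 : ℝ)).is_linear_preimage (LinearMap.snd ℝ ℝ ℝ).isLinear
  | lower w => exact (convex_Iio (0 : ℝ)).is_linear_preimage (LinearMap.snd ℝ ℝ ℝ).isLinear
  | gap j w => exact (hγ j).convex.is_linear_preimage (LinearMap.fst ℝ ℝ ℝ).isLinear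

theorem region_inter_parent (S : Finset ℝ) (γ : ℝ → L) (hγ : ∀ j, ∃ x ∉ S, γ x = j)
    (a : PlanePiece L) (ha : 0 < a.depth) : (a.region S γ ∩ a.parent.region S γ).Nonempty := by
  cases a with
  | upper w =>
    cases h : w.1.head? with
    | none => simp_all [depth, ReducedWord.length]
    | some j =>
      obtain ⟨x, hx, hxj⟩ := hγ j
      exact ⟨(x, 1), by simp [region, parent, h, hx, hxj]⟩
  | lower w =>
    cases h : w.1.head? with
    | none => simp_all [depth, ReducedWord.length]
    | some j =>
      obtain ⟨x, hx, hxj⟩ := hγ j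
      exact ⟨(x, -1), by simp [region, parent, h, hx, hxj]⟩
  | gap j w =>
    obtain ⟨x, hx, hxj⟩ := hγ j
    by_cases h : w.length < (w.flip j).length
    · exact ⟨(x, -1), by simp [region, parent, h, hx, hxj]⟩
    · exact ⟨(x, 1), by simp [region, parent, h, hx, hxj]⟩

end PlanePiece

theorem exists_finset_parent_closed {A : Type*} (depth : A → ℕ) (parent : A → A)
    (h : ∀ a, 0 < depth a → depth (parent a) < depth a) (T : Finset A) :
    ∃ T' : Finset A, T ⊆ T' ∧ ∀ a ∈ T', 0 < depth a → parent a ∈ T' := by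
  classical
  have key : ∀ n a, depth a = n →
      ∃ T' : Finset A, a ∈ T' ∧ ∀ a ∈ T', 0 < depth a → parent a ∈ T' := by
    intro n
    induction n using Nat.strong_induction_on with
    | _ n ih =>
    intro a ha
    by_cases h0 : 0 < depth a
    · obtain ⟨T', h1, h2⟩ := ih _ (ha ▸ h a h0) (parent a) rfl
      refine ⟨insert a T', by simp, fun b hb hb0 ↦ ?_⟩
      rcases Finset.mem_insert.1 hb with rfl | hb
      · exact Finset.mem_insert_of_mem h1
      · exact Finset.mem_insert_of_mem (h2 b hb hb0)
    · refine ⟨{a}, by simp, fun b hb hb0 ↦ ?_⟩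
      rw [Finset.mem_singleton] at hb
      exact absurd (hb ▸ hb0) h0
  choose! T' h1 h2 using fun a ↦ key _ a rfl
  refine ⟨T.biUnion T', fun a ha ↦ Finset.mem_biUnion.2 ⟨a, ha, h1 a⟩, fun a ha ha0 ↦ ?_⟩
  obtain ⟨b, hb, hab⟩ := Finset.mem_biUnion.1 ha
  exact Finset.mem_biUnion.2 ⟨b, hb, h2 b a hab ha0⟩

/-- The plane punctured at finitely many points of the horizontal axis. -/
def AxisPuncturedPlane (S : Finset ℝ) : Set (ℝ × ℝ) := {p | p.2 ≠ 0 ∨ p.1 ∉ S}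

open PlanePiece in
theorem AxisPuncturedPlane.homotopicRel_const {K : Type*} [TopologicalSpace K] [CompactSpace K]
    [T2Space K] [SimplyConnectedSpace K] [LocallyPathConnectedSpace K] {B : Set K}
    (hB : IsClosed B) (hBc : IsConnected B) (S : Finset ℝ) (x : AxisPuncturedPlane S)
    (hx : (x : ℝ × ℝ).2 < 0) (f : C(K, AxisPuncturedPlane S)) (hf : ∀ k ∈ B, f k = x) :
    f.HomotopicRel (ContinuousMap.const K x) B := by
  classical
  obtain ⟨L, γ, hγs, hγc, hγl⟩ := exists_gap_labelling S
  have hSo : IsOpen {t : ℝ | t ∉ S} := S.finite_toSet.isClosed.isOpen_compl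
  let X : K → ℝ := fun k ↦ (f k : ℝ × ℝ).1
  let Y : K → ℝ := fun k ↦ (f k : ℝ × ℝ).2
  have hX : Continuous X := by fun_prop
  have hY : Continuous Y := by fun_prop
  have hG : IsOpen {k | X k ∉ S} := hSo.preimage hX
  have hYp : IsOpen {k | 0 < Y k} := isOpen_lt continuous_const hY
  have hYn : IsOpen {k | Y k < 0} := isOpen_lt hY continuous_const
  have hBY : ∀ k ∈ B, Y k < 0 := fun k hk ↦ by simpa [Y, hf k hk] using hx
  obtain ⟨k₀, hk₀⟩ := hBc.nonempty
  have hP : IsOpen {k | 0 < Y k ∨ X k ∉ S} := hYp.union hG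
  have hN : IsOpen {k | Y k < 0 ∨ X k ∉ S} := hYn.union hG
  have hcover : ∀ k, Y k ≠ 0 ∨ X k ∉ S := fun k ↦ (f k).2
  have hPN : ∀ k, (0 < Y k ∨ X k ∉ S) → (Y k < 0 ∨ X k ∉ S) → X k ∉ S := fun k h h' ↦ by
    rcases h with h | h
    · rcases h' with h' | h'
      · exact absurd h h'.not_gt
      · exact h'
    · exact h
  obtain ⟨u, v, hu, hv, huv, hv₀⟩ := exists_reducedWord_labelling hP hN
    (by
      refine Set.eq_univ_of_forall fun k ↦ ?_
      rcases hcover k with h | h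
      · rcases lt_or_gt_of_ne h with h | h
        · exact Or.inr (Or.inl h)
        · exact Or.inl (Or.inl h)
      · exact Or.inl (Or.inr h))
    (fun k ↦ γ (X k)) (fun k hk ↦ hX.continuousAt.eventually (hγl _ (hPN k hk.1 hk.2)))
    (k₀ := k₀) (Or.inl (hBY k₀ hk₀))
  have hvB : ∀ k ∈ B, v k = .nil := fun k hk ↦
    (hBc.isPreconnected.constant (hv.mono fun k hk ↦ Or.inl (hBY k hk)) hk hk₀).trans hv₀
  let W : PlanePiece L → Set K := fun a ↦ match a with
    | upper w => {k | 0 < Y k ∧ u k = w}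
    | lower w => {k | Y k < 0 ∧ v k = w}
    | gap j w => {k | X k ∉ S ∧ γ (X k) = j ∧ v k = w}
  have hWo : ∀ a, IsOpen (W a) := by
    rintro (w | w | ⟨j, w⟩)
    · convert! hYp.inter (hu.isOpen_inter_preimage hP (isOpen_discrete {w})) using 1
      ext k
      simp only [W, Set.mem_ofPred_eq, Set.mem_inter_iff, Set.mem_preimage, Set.mem_singleton_iff]
      tauto
    · convert! hYn.inter (hv.isOpen_inter_preimage hN (isOpen_discrete {w})) using 1
      ext k
      simp only [W, Set.mem_ofPred_eq, Set.mem_inter_iff, Set.mem_preimage, Set.mem_singleton_iff]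
      tauto
    · have : IsOpen {k | X k ∉ S ∧ γ (X k) = j} := by
        refine IsOpen.preimage (t := {t | t ∉ S ∧ γ t = j}) hX (isOpen_iff_mem_nhds.2 ?_)
        rintro t ⟨ht, rfl⟩
        filter_upwards [hSo.mem_nhds ht, hγl t ht] with s hs hs'
        exact ⟨hs, hs'⟩
      convert! this.inter (hv.isOpen_inter_preimage hN (isOpen_discrete {w})) using 1
      ext k
      simp only [W, Set.mem_ofPred_eq, Set.mem_inter_iff, Set.mem_preimage, Set.mem_singleton_iff]
      tauto
  have hWW : ∀ a b, ∀ k ∈ W a, k ∈ W b → a = b ∨ Adj a b := by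
    have upper_gap : ∀ w j w' k, k ∈ W (upper w) → k ∈ W (gap j w') →
        Adj (upper w) (gap j w') := by
      rintro w j w' k ⟨h, rfl⟩ ⟨h', rfl, rfl⟩
      rw [huv k ⟨Or.inr h', Or.inr h'⟩]
      exact adj_upper_gap _ _
    have lower_gap : ∀ w j w' k, k ∈ W (lower w) → k ∈ W (gap j w') →
        Adj (lower w) (gap j w') := by
      rintro w j w' k ⟨h, rfl⟩ ⟨h', rfl, rfl⟩
      exact adj_lower_gap _ _
    rintro (w | w | ⟨j, w⟩) (w' | w' | ⟨j', w'⟩) k hk hk'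
    · exact Or.inl (by rw [← hk.2, ← hk'.2])
    · exact absurd hk.1 hk'.1.not_gt
    · exact Or.inr (upper_gap _ _ _ k hk hk')
    · exact absurd hk.1 hk'.1.not_gt
    · exact Or.inl (by rw [← hk.2, ← hk'.2])
    · exact Or.inr (lower_gap _ _ _ k hk hk')
    · exact Or.inr (upper_gap _ _ _ k hk' hk).symm
    · exact Or.inr (lower_gap _ _ _ k hk' hk).symm
    · exact Or.inl (by rw [← hk.2.1, ← hk.2.2, ← hk'.2.1, ← hk'.2.2])
  let a₀ : PlanePiece L := lower .nil
  have hWB : B ⊆ W a₀ := fun k hk ↦ ⟨hBY k hk, hvB k hk⟩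
  let V : PlanePiece L → Set K := fun a ↦ if a = a₀ then W a else W a \ B
  have hVW : ∀ a, V a ⊆ W a := fun a ↦ by
    by_cases h : a = a₀
    · simp [V, h]
    · simp [V, h]
  have hVo : ∀ a, IsOpen (V a) := fun a ↦ by
    by_cases h : a = a₀
    · simpa [V, h] using hWo a₀
    · simpa [V, h] using (hWo a).sdiff hB
  have hVc : ∀ k, ∃ a, k ∈ V a := by
    intro k
    by_cases hk : k ∈ B
    · exact ⟨a₀, by simpa [V] using hWB hk⟩
    · have : ∃ a, k ∈ W a := by
        rcases hcover k with h | h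
        · rcases lt_or_gt_of_ne h with h | h
          · exact ⟨lower (v k), h, rfl⟩
          · exact ⟨upper (u k), h, rfl⟩
        · exact ⟨gap _ (v k), h, rfl, rfl⟩
      obtain ⟨a, ha⟩ := this
      refine ⟨a, ?_⟩
      by_cases h : a = a₀
      · simpa [V, h] using h ▸ ha
      · simpa [V, h] using ⟨ha, hk⟩
  obtain ⟨T₀, hT₀⟩ := isCompact_univ.elim_finite_subcover V hVo
    (fun k _ ↦ Set.mem_iUnion.2 (hVc k))
  obtain ⟨T, hT₀T, hT⟩ := exists_finset_parent_closed depth parent depth_parent_lt (insert a₀ T₀)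
  refine homotopicRel_const_of_tree hBc.nonempty depth parent depth_parent_lt (region S γ) ?_
    (convex_region S γ hγc) (fun a ha _ ↦ region_inter_parent S γ hγs a ha) a₀ rfl x T
    (hT₀T (Finset.mem_insert_self _ _)) hT V f hf (fun a _ ↦ hVo a) ?_ ?_
    (by simpa [V] using hWB) ?_ (fun a _ b _ k hk hk' ↦ hWW a b k (hVW a hk) (hVW b hk'))
  · rintro (w | w | ⟨j, w⟩) p hp
    · exact Or.inl (ne_of_gt hp)
    · exact Or.inl (ne_of_lt hp)
    · exact Or.inr hp.1
  · intro k
    obtain ⟨a, ha, hka⟩ := Set.mem_iUnion₂.1 (hT₀ (Set.mem_univ k))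
    exact ⟨a, hT₀T (Finset.mem_insert_of_mem ha), hka⟩
  · intro a _ k hk
    have := hVW a hk
    rcases a with w | w | ⟨j, w⟩
    · exact this.1
    · exact this.1
    · exact ⟨this.1, this.2.1⟩
  · intro a _ ha
    simp only [V, ha, if_false]
    exact Set.disjoint_sdiff_left

theorem isClosed_cubeBoundary (m : ℕ) : IsClosed (Cube.boundary (Fin m)) := by
  have : Cube.boundary (Fin m) = ⋃ i, {y : I^ (Fin m) | y i = 0} ∪ {y | y i = 1} := by
    ext y
    simp [Cube.boundary]
  rw [this]
  exact isClosed_iUnion_of_finite fun i ↦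
    (isClosed_eq (continuous_apply i) continuous_const).union
      (isClosed_eq (continuous_apply i) continuous_const)

theorem isConnected_cubeBoundary {m : ℕ} (hm : 2 ≤ m) : IsConnected (Cube.boundary (Fin m)) := by
  have : Nontrivial (Fin m) := Fin.nontrivial_iff_two_le.2 hm
  have h0 : (0 : I^ (Fin m)) ∈ Cube.boundary (Fin m) := ⟨⟨0, by omega⟩, Or.inl rfl⟩
  refine IsPathConnected.isConnected ⟨0, h0, fun {y} hy ↦ ?_⟩
  obtain ⟨i, hi⟩ := hy
  obtain ⟨j, hj⟩ := exists_ne i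
  have h1 : JoinedIn (Cube.boundary (Fin m)) (Function.update y j 0) y := by
    refine ⟨⟨⟨fun t ↦ Function.update y j (t * y j), by fun_prop⟩, ?_, ?_⟩, fun t ↦ ⟨i, ?_⟩⟩
    · simp
    · simp
    · simpa [hj.symm] using hi
  have h2 : JoinedIn (Cube.boundary (Fin m)) 0 (Function.update y j 0) := by
    refine ⟨⟨⟨fun t i ↦ t * Function.update y j 0 i, by fun_prop⟩, ?_, ?_⟩, fun t ↦ ⟨j, ?_⟩⟩
    · ext; simp
    · ext; simp
    · simp
  exact h2.trans h1

/-- Finitely many points of the plane can be moved to the horizontal axis by a homeomorphism that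
moves a prescribed further point to the lower half-plane. -/
theorem exists_homeomorph_axisPunctured (Q : Finset (EuclideanSpace ℝ (Fin 2)))
    (x : EuclideanSpace ℝ (Fin 2)) (hx : x ∉ Q) :
    ∃ (e : EuclideanSpace ℝ (Fin 2) ≃ₜ ℝ × ℝ) (S : Finset ℝ),
      (∀ p, p ∉ Q ↔ e p ∈ AxisPuncturedPlane S) ∧ (e x).2 < 0 := by
  classical
  obtain ⟨c, hc⟩ : ∃ c : ℝ, Set.InjOn (fun p : EuclideanSpace ℝ (Fin 2) ↦ p 0 + c * p 1)
      (insert x Q : Finset _) := by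
    let bad : Finset ℝ := ((insert x Q) ×ˢ (insert x Q)).image
      fun z ↦ -(z.1 0 - z.2 0) / (z.1 1 - z.2 1)
    obtain ⟨c, hc⟩ := Infinite.exists_notMem_finset bad
    refine ⟨c, fun p hp q hq hpq ↦ ?_⟩
    have hpq' : p 0 + c * p 1 = q 0 + c * q 1 := hpq
    by_cases h1 : p 1 = q 1
    · rw [h1] at hpq'
      ext i
      fin_cases i
      · simpa using hpq'
      · simpa using h1
    · refine absurd (Finset.mem_image.2 ⟨(p, q), Finset.mem_product.2 ⟨hp, hq⟩, ?_⟩) hc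
      have : p 1 - q 1 ≠ 0 := sub_ne_zero.2 h1
      field_simp
      linarith
  let φ := Lagrange.interpolate (insert x Q) (fun p ↦ p 0 + c * p 1)
    (fun p ↦ if p = x then p 1 + 1 else p 1)
  have hφ : ∀ p ∈ insert x Q, φ.eval (p 0 + c * p 1) = if p = x then p 1 + 1 else p 1 :=
    fun p hp ↦ Lagrange.eval_interpolate_at_node _ hc hp
  let e : EuclideanSpace ℝ (Fin 2) ≃ₜ ℝ × ℝ :=
    { toFun := fun p ↦ (p 0 + c * p 1, p 1 - φ.eval (p 0 + c * p 1))
      invFun := fun z ↦ !₂[z.1 - c * (z.2 + φ.eval z.1), z.2 + φ.eval z.1]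
      left_inv := fun p ↦ by
        ext i
        fin_cases i <;> simp
      right_inv := fun z ↦ by simp
      continuous_toFun := by fun_prop
      continuous_invFun := by
        refine (PiLp.continuous_toLp 2 _).comp (continuous_pi fun i ↦ ?_)
        fin_cases i <;> simp <;> fun_prop }
  refine ⟨e, Q.image fun p ↦ (e p).1, fun p ↦ ?_, ?_⟩
  · have hQ : ∀ q ∈ Q, (e q).2 = 0 := fun q hq ↦ by
      have hqx : q ≠ x := fun h ↦ hx (h ▸ hq)
      have := hφ q (Finset.mem_insert_of_mem hq)
      simp only [hqx, if_false] at this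
      simp [e, this]
    have : p ∈ Q ↔ (e p).2 = 0 ∧ (e p).1 ∈ Q.image fun p ↦ (e p).1 := by
      refine ⟨fun hp ↦ ⟨hQ p hp, Finset.mem_image_of_mem _ hp⟩, fun ⟨h, h'⟩ ↦ ?_⟩
      obtain ⟨q, hq, hqp⟩ := Finset.mem_image.1 h'
      rwa [← e.injective (Prod.ext hqp ((hQ q hq).trans h.symm))]
    rw [this, not_and_or]
    rfl
  · have := hφ x (Finset.mem_insert_self _ _)
    simp only [if_true] at this
    simp [e, this]

theorem homotopicRel_const_of_notMem_finset {K : Type*} [TopologicalSpace K] [CompactSpace K]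
    [T2Space K] [SimplyConnectedSpace K] [LocallyPathConnectedSpace K] {B : Set K}
    (hB : IsClosed B) (hBc : IsConnected B) (Q : Finset (EuclideanSpace ℝ (Fin 2)))
    (x : {p // p ∉ Q}) (f : C(K, {p // p ∉ Q})) (hf : ∀ k ∈ B, f k = x) :
    f.HomotopicRel (ContinuousMap.const K x) B := by
  obtain ⟨e, S, he, hx⟩ := exists_homeomorph_axisPunctured Q x x.2
  let a : C({p // p ∉ Q}, AxisPuncturedPlane S) :=
    ⟨fun p ↦ ⟨e p, (he p).1 p.2⟩, by fun_prop⟩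
  let b : C(AxisPuncturedPlane S, {p // p ∉ Q}) :=
    ⟨fun p ↦ ⟨e.symm p, (he _).2 (by simp)⟩, by fun_prop⟩
  have hba : ∀ p, b (a p) = p := fun p ↦ by ext1; simp [a, b]
  have := (AxisPuncturedPlane.homotopicRel_const hB hBc S (a x) hx (a.comp f)
    (fun k hk ↦ by simp [hf k hk])).comp_continuousMap b
  convert! this using 1
  · ext1 k; simp [hba]
  · ext1 k; simp [hba]

theorem simplyConnectedSpace_cube (m : ℕ) : SimplyConnectedSpace (I^ (Fin m)) := by
  have : ContractibleSpace (I^ (Fin m)) := by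
    refine (contractible_iff_id_nullhomotopic _).2 ⟨0, ⟨ContinuousMap.Homotopy.symm
      ⟨⟨fun z i ↦ z.1 * z.2 i, by fun_prop⟩, fun y ↦ ?_, fun y ↦ ?_⟩⟩⟩
    · ext; simp
    · ext; simp
  infer_instance

theorem locallyPathConnectedSpace_cube (m : ℕ) : LocallyPathConnectedSpace (I^ (Fin m)) := by
  let s : (Fin m → ℝ) → (I^ (Fin m)) := fun y i ↦ Set.projIcc 0 1 zero_le_one (y i)
  have hs : Continuous s :=
    continuous_pi fun i ↦ continuous_projIcc.comp (continuous_apply i)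
  have : Topology.IsQuotientMap s := Topology.IsQuotientMap.of_inverse
    (f := fun (y : I^ (Fin m)) i ↦ (y i : ℝ)) (by fun_prop) hs fun y ↦ by ext i; simp [s]
  exact this.locallyPathConnectedSpace

namespace PConf

section TopologicalSpace

variable {E : Type*} [TopologicalSpace E] {n : ℕ}

/-- Forget the first point of a configuration. -/
def tail : C(PConf (n + 1) E, PConf n E) :=
  ⟨fun y ↦ ⟨fun i ↦ y.1 i.succ, y.2.comp (Fin.succ_injective n)⟩,
    (continuous_pi fun i ↦ (continuous_apply i.succ).comp continuous_subtype_val).subtype_mk _⟩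

theorem apply_zero_ne_tail (y : PConf (n + 1) E) (i : Fin n) : y.1 0 ≠ (tail y).1 i :=
  fun h ↦ (Fin.succ_ne_zero i).symm (y.2 h)

/-- Add a point to a configuration. -/
def cons (z : E) (y : PConf n E) (h : ∀ i, z ≠ y.1 i) : PConf (n + 1) E :=
  ⟨Fin.cons z y.1, Fin.cons_injective_iff.2 ⟨fun ⟨i, hi⟩ ↦ h i hi.symm, y.2⟩⟩

theorem tail_cons (z : E) (y : PConf n E) (h : ∀ i, z ≠ y.1 i) : tail (cons z y h) = y := rfl

theorem cons_zero_tail (y : PConf (n + 1) E) (w : PConf n E) (hw : tail y = w) (z : E)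
    (hz : z = y.1 0) (h : ∀ i, z ≠ w.1 i) : cons z w h = y := by
  subst hw hz
  exact Subtype.ext (Fin.cons_self_tail y.1)

theorem continuous_cons {Y : Type*} [TopologicalSpace Y] {z : Y → E} {w : Y → PConf n E}
    (hz : Continuous z) (hw : Continuous w) (h : ∀ y i, z y ≠ (w y).1 i) :
    Continuous fun y ↦ cons (z y) (w y) (h y) := by
  refine Continuous.subtype_mk (continuous_pi fun i ↦ ?_) _
  refine Fin.cases ?_ (fun i ↦ ?_) i
  · simpa using hz
  · exact (continuous_apply i).comp (continuous_subtype_val.comp hw)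

end TopologicalSpace

variable {E : Type*} [NormedAddCommGroup E] [NormedSpace ℝ E] {n : ℕ}

/-- Drag `z` along with the points of the configuration `x` which move to `y`, where the influence
of every point extends to radius `r`. -/
noncomputable def drag (r : ℝ) (x y : Fin n → E) (z : E) : E :=
  z + ∑ i, max 0 (1 - ‖z - x i‖ / r) • (y i - x i)

theorem drag_self (r : ℝ) (x : Fin n → E) (z : E) : drag r x x z = z := by simp [drag]

theorem drag_ne {r ε : ℝ} (hr : 0 < r) (hε : (n + 1) * ε < r) {x y : Fin n → E}
    (hx : ∀ i j, i ≠ j → 2 * r ≤ ‖x i - x j‖) (hxy : ∀ i, ‖y i - x i‖ ≤ ε) {z : E}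
    (hz : ∀ i, z ≠ x i) (j : Fin n) : drag r x y z ≠ y j := by
  intro h
  have hε0 : 0 ≤ ε := (norm_nonneg _).trans (hxy j)
  have hzj : z - x j = (y j - x j) - ∑ i, max 0 (1 - ‖z - x i‖ / r) • (y i - x i) := by
    rw [← h, drag]; abel
  have hsum : ‖∑ i, max 0 (1 - ‖z - x i‖ / r) • (y i - x i)‖ ≤ n * ε := by
    refine (norm_sum_le_of_le (f := fun i ↦ max 0 (1 - ‖z - x i‖ / r) • (y i - x i))
      Finset.univ (n := fun _ ↦ ε) fun i _ ↦ ?_).trans (by simp)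
    rw [norm_smul, Real.norm_of_nonneg (le_max_left _ _)]
    have h1 : max 0 (1 - ‖z - x i‖ / r) ≤ 1 := max_le zero_le_one (sub_le_self _ (by positivity))
    calc _ ≤ 1 * ‖y i - x i‖ := by gcongr
      _ ≤ ε := by simpa using hxy i
  have hlt : ‖z - x j‖ < r := by
    calc ‖z - x j‖ ≤ ‖y j - x j‖ + _ := hzj ▸ norm_sub_le _ _
      _ ≤ ε + n * ε := add_le_add (hxy j) hsum
      _ < r := by linarith
  rw [Finset.sum_eq_single j (fun i _ hij ↦ ?_) (by simp)] at hzj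
  · have hle : ‖z - x j‖ / r ≤ 1 := (div_le_one hr).2 hlt.le
    rw [max_eq_right (by linarith), ← one_smul ℝ (y j - x j), smul_smul, ← sub_smul] at hzj
    have hnorm := congrArg norm hzj
    rw [norm_smul, Real.norm_of_nonneg (by ring_nf; positivity)] at hnorm
    have hpos : 0 < ‖z - x j‖ := norm_pos_iff.2 (sub_ne_zero.2 (hz j))
    have hεr : ε < r := by nlinarith [mul_nonneg (Nat.cast_nonneg (α := ℝ) n) hε0]
    have : ‖z - x j‖ < ‖z - x j‖ := by
      calc ‖z - x j‖ = (1 - (1 - ‖z - x j‖ / r) * 1) * ‖y j - x j‖ := hnorm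
        _ = ‖z - x j‖ / r * ‖y j - x j‖ := by ring
        _ ≤ ‖z - x j‖ / r * ε := by gcongr; exact hxy j
        _ < ‖z - x j‖ / r * r := by gcongr
        _ = ‖z - x j‖ := by field_simp
    exact lt_irrefl _ this
  · have h1 : 2 * r ≤ ‖z - x i‖ + ‖z - x j‖ := by
      refine (hx i j hij).trans ?_
      rw [← norm_neg (z - x i)]
      convert! norm_sub_le (-(z - x i)) (-(z - x j)) using 2
      · abel
      · rw [norm_neg]
    have h2 : 1 ≤ ‖z - x i‖ / r := (one_le_div hr).2 (by linarith)
    rw [max_eq_left (by linarith), zero_smul]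

theorem exists_homotopicRel_lift_of_small {K : Type*} [TopologicalSpace K] {B : Set K} {r ε : ℝ}
    (hr : 0 < r) (hε : (n + 1) * ε < r) (G : C(I × K, PConf n E))
    (hGB : ∀ t, ∀ k ∈ B, G (t, k) = G (0, k))
    (hGr : ∀ k i j, i ≠ j → 2 * r ≤ ‖(G (0, k)).1 i - (G (0, k)).1 j‖)
    (hGε : ∀ t k i, ‖(G (t, k)).1 i - (G (0, k)).1 i‖ ≤ ε)
    (f : C(K, PConf (n + 1) E)) (hf : ∀ k, tail (f k) = G (0, k)) :
    ∃ f' : C(K, PConf (n + 1) E), f.HomotopicRel f' B ∧ ∀ k, tail (f' k) = G (1, k) := by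
  have hne : ∀ (z : I × K) (i : Fin n),
      drag r (G (0, z.2)).1 (G z).1 ((f z.2).1 0) ≠ (G z).1 i := fun z i ↦
    drag_ne hr hε (hGr z.2) (hGε z.1 z.2)
      (fun i ↦ by rw [← hf]; exact apply_zero_ne_tail _ i) i
  have hcont : Continuous fun z : I × K ↦ drag r (G (0, z.2)).1 (G z).1 ((f z.2).1 0) := by
    unfold drag
    have h0 : Continuous fun z : I × K ↦ (f z.2).1 0 :=
      (continuous_apply 0).comp (continuous_subtype_val.comp (f.continuous.comp continuous_snd))
    have h1 : ∀ i, Continuous fun z : I × K ↦ (G z).1 i := fun i ↦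
      (continuous_apply i).comp (continuous_subtype_val.comp G.continuous)
    have h2 : ∀ i, Continuous fun z : I × K ↦ (G (0, z.2)).1 i := fun i ↦
      (h1 i).comp (continuous_const.prodMk continuous_snd)
    refine h0.add (continuous_finsetSum _ fun i _ ↦ ?_)
    exact (continuous_const.max (continuous_const.sub ((h0.sub (h2 i)).norm.div_const r))).smul
      ((h1 i).sub (h2 i))
  let F : C(I × K, PConf (n + 1) E) := ⟨_, continuous_cons hcont G.continuous hne⟩
  have hF : ∀ t k, G (t, k) = G (0, k) → F (t, k) = f k := fun t k h ↦
    cons_zero_tail _ _ ((hf k).trans h.symm) _ (by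
      change drag r (G (0, k)).1 (G (t, k)).1 _ = _
      rw [h, drag_self]) (hne (t, k))
  exact ⟨⟨fun k ↦ F (1, k), by fun_prop⟩, ⟨⟨⟨F, fun k ↦ hF 0 k rfl, fun k ↦ rfl⟩,
    fun t k hk ↦ hF t k (hGB t k hk)⟩⟩, fun k ↦ tail_cons _ _ (hne (1, k))⟩

theorem exists_homotopicRel_lift {K : Type*} [PseudoMetricSpace K] [CompactSpace K] {B : Set K}
    (f : C(K, PConf (n + 1) E)) (g : C(K, PConf n E)) (H : (tail.comp f).HomotopyRel g B) :
    ∃ f' : C(K, PConf (n + 1) E), f.HomotopicRel f' B ∧ tail.comp f' = g := by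
  rcases isEmpty_or_nonempty K with hK | hK
  · exact ⟨f, .refl _, by ext1 k; exact hK.elim k⟩
  have hHi : ∀ i, Continuous fun z : I × K ↦ (H z).1 i := fun i ↦
    (continuous_apply i).comp (continuous_subtype_val.comp H.continuous)
  obtain ⟨r, hr, hHr⟩ : ∃ r > 0, ∀ z i j, i ≠ j → 2 * r ≤ ‖(H z).1 i - (H z).1 j‖ := by
    have : ∀ q : Fin n × Fin n, ∃ r > 0, q.1 ≠ q.2 → ∀ z, 2 * r ≤ ‖(H z).1 q.1 - (H z).1 q.2‖ := by
      rintro ⟨i, j⟩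
      by_cases hij : i = j
      · exact ⟨1, one_pos, fun h ↦ absurd hij h⟩
      · obtain ⟨z, -, hz⟩ := isCompact_univ.exists_isMinOn (Set.univ_nonempty (α := I × K))
          ((hHi i).sub (hHi j)).norm.continuousOn
        have : 0 < ‖(H z).1 i - (H z).1 j‖ :=
          norm_pos_iff.2 (sub_ne_zero.2 fun h ↦ hij ((H z).2 h))
        refine ⟨‖(H z).1 i - (H z).1 j‖ / 2, by positivity, fun _ y ↦ ?_⟩
        have hy : ‖(H z).1 i - (H z).1 j‖ ≤ ‖(H y).1 i - (H y).1 j‖ := hz (Set.mem_univ y)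
        change _ ≤ ‖(H y).1 i - (H y).1 j‖
        linarith
    choose ρ hρ hρ' using this
    obtain ⟨r, hr, hrρ⟩ : ∃ r > 0, ∀ q, r ≤ ρ q := by
      rcases isEmpty_or_nonempty (Fin n × Fin n) with h | h
      · exact ⟨1, one_pos, fun q ↦ h.elim q⟩
      · obtain ⟨q, hq⟩ := Finite.exists_min ρ
        exact ⟨ρ q, hρ q, hq⟩
    exact ⟨r, hr, fun z i j hij ↦ by linarith [hρ' (i, j) hij z, hrρ (i, j)]⟩
  let ε := r / (n + 2)
  have hε : 0 < ε := by positivity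
  have hεr : (n + 1) * ε < r := by
    have : (n + 2) * ε = r := by simp only [ε]; field_simp
    linarith
  have huc : UniformContinuous fun z : I × K ↦ (H z).1 :=
    CompactSpace.uniformContinuous_of_continuous (continuous_subtype_val.comp H.continuous)
  obtain ⟨δ, hδ, hHδ⟩ := Metric.uniformContinuous_iff.1 huc ε hε
  obtain ⟨N, hN⟩ := exists_nat_one_div_lt hδ
  let p : ℝ → I := Set.projIcc 0 1 zero_le_one
  have hp : Continuous p := continuous_projIcc
  have key : ∀ j : ℕ, ∃ f' : C(K, PConf (n + 1) E), f.HomotopicRel f' B ∧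
      ∀ k, tail (f' k) = H (p (j / (N + 1)), k) := by
    intro j
    induction j with
    | zero =>
      refine ⟨f, .refl _, fun k ↦ ?_⟩
      have : p ((0 : ℕ) / (N + 1)) = 0 := by simp [p]
      rw [this, H.apply_zero]
      rfl
    | succ j ih =>
      obtain ⟨f₁, hf₁, hf₁'⟩ := ih
      let G : C(I × K, PConf n E) := ⟨fun z ↦ H (p ((j + z.1) / (N + 1)), z.2), by fun_prop⟩
      have hG0 : ∀ k, G (0, k) = H (p (j / (N + 1)), k) := fun k ↦ by simp [G]
      have hGε : ∀ t k i, ‖(G (t, k)).1 i - (G (0, k)).1 i‖ ≤ ε := fun t k i ↦ by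
        have hd : dist (p ((j + t) / (N + 1)), k) (p ((j + (0 : I)) / (N + 1)), k) < δ := by
          rw [Prod.dist_eq, dist_self, max_lt_iff]
          refine ⟨?_, hδ⟩
          refine lt_of_le_of_lt ?_ hN
          rw [Subtype.dist_eq, Real.dist_eq]
          refine (Set.abs_projIcc_sub_projIcc zero_le_one).trans ?_
          rw [← sub_div, abs_div, abs_of_pos (by positivity : (0 : ℝ) < N + 1)]
          gcongr
          rw [show (j : ℝ) + t - (j + (0 : I)) = t by simp, abs_of_nonneg t.2.1]
          exact t.2.2
        have := hHδ hd
        rw [dist_eq_norm] at this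
        exact (norm_le_pi_norm ((G (t, k)).1 - (G (0, k)).1) i).trans this.le
      obtain ⟨f₂, hf₂, hf₂'⟩ := exists_homotopicRel_lift_of_small (B := B) hr hεr G
        (fun t k hk ↦ (H.eq_fst _ hk).trans (H.eq_fst _ hk).symm)
        (fun k ↦ hHr _) hGε f₁ (fun k ↦ (hf₁' k).trans (hG0 k).symm)
      refine ⟨f₂, hf₁.trans hf₂, fun k ↦ (hf₂' k).trans ?_⟩
      simp [G]
  obtain ⟨f', hf', hf''⟩ := key (N + 1)
  refine ⟨f', hf', ?_⟩
  ext1 k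
  have : p ((N + 1 : ℕ) / (N + 1)) = 1 := by
    have : ((N + 1 : ℕ) : ℝ) / (N + 1) = 1 := by push_cast; field_simp
    rw [this]
    simp [p]
  rw [ContinuousMap.comp_apply, hf'', this, H.apply_one]

theorem homotopicRel_const {K : Type*} [MetricSpace K] [CompactSpace K] [SimplyConnectedSpace K]
    [LocallyPathConnectedSpace K] {B : Set K} (hB : IsClosed B) (hBc : IsConnected B) (n : ℕ)
    (x : PConf n (EuclideanSpace ℝ (Fin 2))) (f : C(K, PConf n (EuclideanSpace ℝ (Fin 2))))
    (hf : ∀ k ∈ B, f k = x) : f.HomotopicRel (ContinuousMap.const K x) B := by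
  classical
  induction n with
  | zero =>
    have : f = ContinuousMap.const K x := by
      ext1 k
      exact Subtype.ext (Subsingleton.elim _ _)
    rw [this]
    exact .refl _
  | succ n ih =>
    obtain ⟨H⟩ := ih (tail x) (tail.comp f) fun k hk ↦ by rw [ContinuousMap.comp_apply, hf k hk]
    obtain ⟨f', hff', hf'⟩ := exists_homotopicRel_lift f _ H
    have hf'k : ∀ k, tail (f' k) = tail x := fun k ↦ DFunLike.congr_fun hf' k
    refine hff'.trans ?_
    have hf'B : ∀ k ∈ B, f' k = x := fun k hk ↦ by
      obtain ⟨H'⟩ := hff'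
      rw [← hf k hk]
      exact (H'.fst_eq_snd hk).symm
    let Q : Finset (EuclideanSpace ℝ (Fin 2)) := Finset.univ.image (tail x).1
    have hQ : ∀ z : {p // p ∉ Q}, ∀ i, z.1 ≠ (tail x).1 i := fun z i h ↦
      z.2 (h ▸ Finset.mem_image_of_mem _ (Finset.mem_univ i))
    have hQ' : ∀ y : PConf (n + 1) (EuclideanSpace ℝ (Fin 2)), tail y = tail x → y.1 0 ∉ Q := by
      intro y hy h
      obtain ⟨i, -, hi⟩ := Finset.mem_image.1 h
      rw [← hy] at hi
      exact apply_zero_ne_tail y i hi.symm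
    let b : C({p // p ∉ Q}, PConf (n + 1) (EuclideanSpace ℝ (Fin 2))) :=
      ⟨fun z ↦ cons z.1 (tail x) (hQ z),
        continuous_cons continuous_subtype_val continuous_const hQ⟩
    let z : C(K, {p // p ∉ Q}) := ⟨fun k ↦ ⟨(f' k).1 0, hQ' _ (hf'k k)⟩,
      ((continuous_apply 0).comp (continuous_subtype_val.comp f'.continuous)).subtype_mk _⟩
    have := (homotopicRel_const_of_notMem_finset hB hBc Q ⟨x.1 0, hQ' x rfl⟩ z
      (fun k hk ↦ Subtype.ext (by simp [z, hf'B k hk]))).comp_continuousMap b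
    convert! this using 1
    · ext1 k
      exact (cons_zero_tail (f' k) _ (hf'k k) _ rfl (hQ (z k))).symm
    · ext1 k
      exact (cons_zero_tail x _ rfl _ rfl (apply_zero_ne_tail x)).symm

end PConf

theorem pconf_R2_aspherical (n : ℕ) (hn : 1 ≤ n) (m : ℕ) (hm : 2 ≤ m)
    (x : PConf n (EuclideanSpace ℝ (Fin 2))) :
    Nonempty (Unique (π_ m (PConf n (EuclideanSpace ℝ (Fin 2))) x)) := by
  have := simplyConnectedSpace_cube m
  have := locallyPathConnectedSpace_cube m
  refine ⟨⟨⟨⟦GenLoop.const⟧⟩, fun a ↦ ?_⟩⟩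
  induction a using Quotient.inductionOn with
  | h f =>
    exact Quotient.sound (PConf.homotopicRel_const (isClosed_cubeBoundary m)
      (isConnected_cubeBoundary hm) n x f.1 f.2)
end

section
/- For every natural number n ≥ 1, the forgetful map f_n(𝕋²) : PConf_{n+1}(𝕋²) → PConf_n(𝕋²) on configuration spaces of the torus admits a continuous section. -/
/-- The forgetful map `f_n(S)` forgetting the 0th point. -/
def forgetPoint (n : ℕ) {S : Type*} (x : PConf (n + 1) S) : PConf n S :=
  ⟨x.1 ∘ Fin.succ, x.2.comp (Fin.succ_injective n)⟩

/-- The torus `ℝ/ℤ × ℝ/ℤ`. -/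
abbrev Torus : Type := UnitAddCircle × UnitAddCircle

/-- A function of a configuration bounded by `1 / 2` and by the distance from the `0`th point to
every other point. -/
noncomputable def separation {m : ℕ} {S : Type*} [Dist S] (x : Fin (m + 1) → S) : ℝ :=
  Finset.univ.inf' Finset.univ_nonempty fun j => if j = 0 then 1 / 2 else dist (x j) (x 0)

theorem continuous_separation {m : ℕ} {S : Type*} [PseudoMetricSpace S] :
    Continuous (separation : (Fin (m + 1) → S) → ℝ) := by
  refine Continuous.finset_inf'_apply _ fun j _ => ?_
  split_ifs <;> fun_prop

theorem separation_le_half {m : ℕ} {S : Type*} [Dist S] (x : Fin (m + 1) → S) :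
    separation x ≤ 1 / 2 :=
  (Finset.inf'_le _ (Finset.mem_univ 0)).trans_eq (if_pos rfl)

theorem separation_le_dist {m : ℕ} {S : Type*} [Dist S] (x : Fin (m + 1) → S)
    {j : Fin (m + 1)} (hj : j ≠ 0) : separation x ≤ dist (x j) (x 0) :=
  (Finset.inf'_le _ (Finset.mem_univ j)).trans_eq (if_neg hj)

theorem separation_pos {m : ℕ} {S : Type*} [MetricSpace S] {x : Fin (m + 1) → S}
    (hx : Function.Injective x) : 0 < separation x := by
  refine (Finset.lt_inf'_iff _).2 fun j _ => ?_
  split_ifs with hj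
  · norm_num
  · exact dist_pos.2 (hx.ne hj)

theorem Torus.norm_coe_zero {t : ℝ} (h0 : 0 ≤ t) (h1 : t ≤ 1 / 2) :
    ‖(((t : UnitAddCircle), 0) : Torus)‖ = t := by
  have h : ‖(t : UnitAddCircle)‖ = |t| :=
    (AddCircle.norm_coe_eq_abs_iff 1 one_ne_zero).2 (by rwa [abs_one, abs_of_nonneg h0])
  simp [Prod.norm_def, h, abs_of_nonneg h0, h0]

/-- The `0`th point of a configuration, moved by half the separation in the first direction. -/
noncomputable def nearbyPoint {m : ℕ} (x : Fin (m + 1) → Torus) : Torus :=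
  x 0 + (((separation x / 2 : ℝ) : UnitAddCircle), 0)

theorem continuous_nearbyPoint {m : ℕ} :
    Continuous (nearbyPoint : (Fin (m + 1) → Torus) → Torus) :=
  (continuous_apply 0).add
    (((AddCircle.continuous_mk' 1).comp (continuous_separation.div_const 2)).prodMk
      continuous_const)

theorem dist_nearbyPoint {m : ℕ} {x : Fin (m + 1) → Torus} (hx : Function.Injective x) :
    dist (nearbyPoint x) (x 0) = separation x / 2 := by
  have h0 := separation_pos hx
  have h1 := separation_le_half x
  rw [dist_eq_norm, nearbyPoint, add_sub_cancel_left,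
    Torus.norm_coe_zero (by linarith) (by linarith)]

theorem nearbyPoint_notMem_range {m : ℕ} {x : Fin (m + 1) → Torus}
    (hx : Function.Injective x) : nearbyPoint x ∉ Set.range x := by
  rintro ⟨j, hj⟩
  have hd := dist_nearbyPoint hx
  have h0 := separation_pos hx
  rw [← hj] at hd
  by_cases h : j = 0
  · rw [h, dist_self] at hd
    linarith
  · linarith [separation_le_dist x h]

theorem section_exists_torus (n : ℕ) (hn : 1 ≤ n) :
    ∃ s : PConf n Torus → PConf (n + 1) Torus,
      Continuous s ∧ ∀ x, forgetPoint n (s x) = x := by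
  obtain ⟨m, rfl⟩ := Nat.exists_eq_add_of_le' hn
  refine ⟨fun x => ⟨Fin.cons (nearbyPoint x.1) x.1,
    Fin.cons_injective_iff.2 ⟨nearbyPoint_notMem_range x.2, x.2⟩⟩, ?_, fun x => ?_⟩
  · refine Continuous.subtype_mk (continuous_pi fun j => ?_) _
    cases j using Fin.cases with
    | zero => exact continuous_nearbyPoint.comp continuous_subtype_val
    | succ j => exact (continuous_apply j).comp continuous_subtype_val
  · rfl
end

section
/- For every natural number n ≥ 2, the forgetful map f_n(ℝ²) : PConf_{n+1}(ℝ²) → PConf_n(ℝ²) admits infinitely many homotopy classes of continuous sections: there exists a sequence (s_m)_{m ∈ ℕ} of continuous sections of f_n(ℝ²) such that s_m and s_{m'} are not homotopic as continuous maps whenever m ≠ m'. -/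
open scoped unitInterval

noncomputable section

/-- The Euclidean plane as the complex line. -/
def planeToComplex : EuclideanSpace ℝ (Fin 2) ≃ₗᵢ[ℝ] ℂ :=
  Complex.orthonormalBasisOneI.repr.symm

/-- Winding numbers are invariant under free homotopies in the punctured plane. -/
theorem winding_eq_of_homotopy (F : C(I × ℝ, {z : ℂ // z ≠ 0})) (a b : ℂ) (m m' : ℕ)
    (hF₀ : ∀ θ : ℝ, (F (0, θ) : ℂ) = Complex.exp (a + 2 * Real.pi * Complex.I * m * θ))
    (hF₁ : ∀ θ : ℝ, (F (1, θ) : ℂ) = b * Complex.exp (2 * Real.pi * Complex.I * m' * θ))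
    (hloop : ∀ t, F (t, 1) = F (t, 0)) : m = m' := by
  let L := Complex.isCoveringMap_exp.liftHomotopy F
    ⟨fun θ : ℝ => a + 2 * Real.pi * Complex.I * m * θ, by fun_prop⟩
    (fun θ => Subtype.ext (hF₀ θ))
  have hL (t : I) (θ : ℝ) : Complex.exp (L (t, θ)) = F (t, θ) :=
    congrArg Subtype.val (congrFun (Complex.isCoveringMap_exp.liftHomotopy_lifts F _ _) (t, θ))
  have hL₀ (θ : ℝ) : L (0, θ) = a + 2 * Real.pi * Complex.I * m * θ :=
    Complex.isCoveringMap_exp.liftHomotopy_zero F _ _ θ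
  have hper (k : ℕ) : Complex.exp (2 * Real.pi * Complex.I * k) = 1 := by
    rw [mul_comm]; exact Complex.exp_nat_mul_two_pi_mul_I k
  have h₁ : L (1, 1) = L (1, 0) + 2 * Real.pi * Complex.I * m := by
    refine congrFun (Complex.isCoveringMap_exp.eq_of_comp_eq
      (g₁ := fun t : I => L (t, 1)) (g₂ := fun t : I => L (t, 0) + 2 * Real.pi * Complex.I * m)
      (by fun_prop) (by fun_prop) ?_ 0 ?_) 1
    · funext t
      apply Subtype.ext
      simp [Complex.exp_add, hper, hL, hloop]
    · simp [hL₀]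
  have h₂ : L (1, 1) = L (1, 0) + 2 * Real.pi * Complex.I * m' := by
    have := congrFun (Complex.isCoveringMap_exp.eq_of_comp_eq
      (g₁ := fun θ : ℝ => L (1, θ))
      (g₂ := fun θ : ℝ => L (1, 0) + 2 * Real.pi * Complex.I * m' * θ)
      (by fun_prop) (by fun_prop) ?_ 0 ?_) 1
    · simpa using this
    · funext θ
      apply Subtype.ext
      simp [Complex.exp_add, hL, hF₁]
    · simp
  have h := add_left_cancel (h₁.symm.trans h₂)
  exact_mod_cast mul_left_cancel₀ Complex.two_pi_I_ne_zero h

theorem continuous_point {n : ℕ} {S : Type*} [TopologicalSpace S] (j : Fin n) :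
    Continuous fun x : PConf n S => x.1 j :=
  (continuous_apply j).comp continuous_subtype_val

/-- Half the distance from the first point of a configuration to the other points. -/
def halfGap {k : ℕ} (x : PConf (k + 2) (EuclideanSpace ℝ (Fin 2))) : ℝ :=
  Finset.univ.inf' Finset.univ_nonempty (fun j : Fin (k + 1) => ‖x.1 j.succ - x.1 0‖) / 2

theorem continuous_halfGap {k : ℕ} : Continuous (halfGap (k := k)) := by
  unfold halfGap
  refine Continuous.div_const (Continuous.finset_inf'_apply _ fun j _ => ?_) 2
  exact ((continuous_point j.succ).sub (continuous_point 0)).norm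

theorem sub_ne_zero_of_pconf {k : ℕ} {S : Type*} [AddGroup S] (x : PConf (k + 2) S)
    (j : Fin (k + 1)) : x.1 j.succ - x.1 0 ≠ 0 :=
  sub_ne_zero.2 fun h => Fin.succ_ne_zero j (x.2 h)

theorem halfGap_pos {k : ℕ} (x : PConf (k + 2) (EuclideanSpace ℝ (Fin 2))) : 0 < halfGap x :=
  half_pos <| (Finset.lt_inf'_iff _).2 fun j _ => norm_pos_iff.2 (sub_ne_zero_of_pconf x j)

theorem halfGap_lt {k : ℕ} (x : PConf (k + 2) (EuclideanSpace ℝ (Fin 2))) (j : Fin (k + 1)) :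
    halfGap x < ‖x.1 j.succ - x.1 0‖ := by
  have h : halfGap x ≤ ‖x.1 j.succ - x.1 0‖ / 2 :=
    div_le_div_of_nonneg_right (Finset.inf'_le _ (Finset.mem_univ j)) (by norm_num)
  have := halfGap_pos x
  linarith

/-- The unit complex number pointing from the first to the second point. -/
def direction {k : ℕ} (x : PConf (k + 2) (EuclideanSpace ℝ (Fin 2))) : ℂ :=
  planeToComplex (x.1 1 - x.1 0) / (‖x.1 1 - x.1 0‖ : ℂ)

theorem continuous_direction {k : ℕ} : Continuous (direction (k := k)) := by
  unfold direction
  refine Continuous.div ?_ ?_ fun x => ?_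
  · exact planeToComplex.continuous.comp ((continuous_point 1).sub (continuous_point 0))
  · exact Complex.continuous_ofReal.comp ((continuous_point 1).sub (continuous_point 0)).norm
  · exact_mod_cast norm_ne_zero_iff.2 (sub_ne_zero_of_pconf x 0)

theorem norm_direction {k : ℕ} (x : PConf (k + 2) (EuclideanSpace ℝ (Fin 2))) :
    ‖direction x‖ = 1 := by
  have h : ‖x.1 1 - x.1 0‖ ≠ 0 := norm_ne_zero_iff.2 (sub_ne_zero_of_pconf x 0)
  rw [direction, norm_div, LinearIsometryEquiv.norm_map, Complex.norm_real, norm_norm, div_self h]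

/-- The displacement of the added point from the first point of the configuration. -/
def displacement {k : ℕ} (m : ℕ) (x : PConf (k + 2) (EuclideanSpace ℝ (Fin 2))) :
    EuclideanSpace ℝ (Fin 2) :=
  planeToComplex.symm (halfGap x * direction x ^ m)

theorem norm_displacement {k : ℕ} (m : ℕ) (x : PConf (k + 2) (EuclideanSpace ℝ (Fin 2))) :
    ‖displacement m x‖ = halfGap x := by
  simp [displacement, norm_direction, abs_of_pos (halfGap_pos x)]

theorem continuous_displacement {k : ℕ} (m : ℕ) : Continuous (displacement (k := k) m) :=
  planeToComplex.symm.continuous.comp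
    ((Complex.continuous_ofReal.comp continuous_halfGap).mul (continuous_direction.pow m))

/-- The section adding a point near the first one, which turns `m` times around the first point
whenever the second one turns once. -/
def windingSection (k m : ℕ) :
    C(PConf (k + 2) (EuclideanSpace ℝ (Fin 2)), PConf (k + 2 + 1) (EuclideanSpace ℝ (Fin 2))) where
  toFun x := ⟨Fin.cons (x.1 0 + displacement m x) x.1, Fin.cons_injective_iff.2 ⟨by
    rintro ⟨j, hj⟩
    have h : ‖x.1 j - x.1 0‖ = halfGap x := by
      rw [hj, add_sub_cancel_left, norm_displacement]
    cases j using Fin.cases with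
    | zero => simpa using (h.trans_ne (halfGap_pos x).ne')
    | succ j => exact (halfGap_lt x j).ne' h, x.2⟩⟩
  continuous_toFun := by
    refine Continuous.subtype_mk (continuous_pi fun i => ?_) _
    cases i using Fin.cases with
    | zero =>
      exact (continuous_point 0).add (continuous_displacement m)
    | succ j => exact continuous_point j

/-- Points `0, 1, …, k + 1` of a line through the origin, rotated by `θ` turns. -/
def rotatingLine (k : ℕ) : C(ℝ, PConf (k + 2) (EuclideanSpace ℝ (Fin 2))) where
  toFun θ := ⟨fun j => planeToComplex.symm
    ((j : ℕ) * Complex.exp (2 * Real.pi * Complex.I * θ)), fun i j h => by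
      have := mul_right_cancel₀ (Complex.exp_ne_zero _) (planeToComplex.symm.injective h)
      exact Fin.ext (by exact_mod_cast this)⟩
  continuous_toFun := by
    refine Continuous.subtype_mk (continuous_pi fun i => ?_) _
    exact planeToComplex.symm.continuous.comp (by fun_prop)

theorem rotatingLine_one (k : ℕ) : rotatingLine k 1 = rotatingLine k 0 := by
  apply Subtype.ext
  simp [rotatingLine, Complex.exp_two_pi_mul_I]

theorem norm_exp_turn (θ : ℝ) : ‖Complex.exp (2 * Real.pi * Complex.I * θ)‖ = 1 := by
  rw [show (2 * Real.pi * Complex.I * θ : ℂ) = ((2 * Real.pi * θ : ℝ) : ℂ) * Complex.I by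
    push_cast; ring]
  exact Complex.norm_exp_ofReal_mul_I _

theorem halfGap_rotatingLine (k : ℕ) (θ : ℝ) :
    halfGap (rotatingLine k θ) = halfGap (rotatingLine k 0) := by
  have h (θ : ℝ) (j : Fin (k + 1)) :
      ‖(rotatingLine k θ).1 j.succ - (rotatingLine k θ).1 0‖ =
        ‖((j.succ : ℕ) - ((0 : Fin (k + 2)) : ℕ) : ℂ)‖ := by
    simp only [rotatingLine, ContinuousMap.coe_mk, ← map_sub, LinearIsometryEquiv.norm_map,
      ← sub_mul, norm_mul, norm_exp_turn, mul_one]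
  simp only [halfGap, h]

theorem direction_rotatingLine (k : ℕ) (θ : ℝ) :
    direction (rotatingLine k θ) = Complex.exp (2 * Real.pi * Complex.I * θ) := by
  simp [direction, rotatingLine, norm_exp_turn]

theorem displacement_rotatingLine (k m : ℕ) (θ : ℝ) :
    planeToComplex (displacement m (rotatingLine k θ)) =
      halfGap (rotatingLine k 0) * Complex.exp (2 * Real.pi * Complex.I * m * θ) := by
  rw [displacement, LinearIsometryEquiv.apply_symm_apply, halfGap_rotatingLine,
    direction_rotatingLine, ← Complex.exp_nat_mul]
  ring_nf

/-- The difference of the first two points of a configuration. -/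
def firstDifference (k : ℕ) : C(PConf (k + 2) (EuclideanSpace ℝ (Fin 2)), {z : ℂ // z ≠ 0}) where
  toFun x := ⟨planeToComplex (x.1 0 - x.1 1), by
    rw [Ne, map_eq_zero_iff _ planeToComplex.injective, sub_eq_zero]
    exact fun h => Fin.zero_ne_one (x.2 h)⟩
  continuous_toFun :=
    Continuous.subtype_mk (planeToComplex.continuous.comp
      ((continuous_point 0).sub (continuous_point 1))) _

theorem firstDifference_windingSection (k m : ℕ) (x : PConf (k + 2) (EuclideanSpace ℝ (Fin 2))) :
    (firstDifference (k + 1) (windingSection k m x) : ℂ) = planeToComplex (displacement m x) := by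
  have h : (windingSection k m x).1 1 = x.1 0 := rfl
  have h₀ : (windingSection k m x).1 0 = x.1 0 + displacement m x := rfl
  simp only [firstDifference, ContinuousMap.coe_mk, h, h₀, add_sub_cancel_left]

theorem eq_of_windingSection_homotopic {k m m' : ℕ}
    (h : (windingSection k m).Homotopic (windingSection k m')) : m = m' := by
  obtain ⟨H⟩ := h
  let F : C(I × ℝ, {z : ℂ // z ≠ 0}) :=
    (firstDifference (k + 1)).comp
      (H.toContinuousMap.comp ((ContinuousMap.id I).prodMap (rotatingLine k)))
  have hF (t : I) (θ : ℝ) : F (t, θ) = firstDifference (k + 1) (H (t, rotatingLine k θ)) := rfl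
  have hr : (halfGap (rotatingLine k 0) : ℂ) ≠ 0 := by
    exact_mod_cast (halfGap_pos (rotatingLine k 0)).ne'
  refine winding_eq_of_homotopy F (Complex.log (halfGap (rotatingLine k 0)))
    (halfGap (rotatingLine k 0)) m m' (fun θ => ?_) (fun θ => ?_) fun t => ?_
  · rw [hF, H.apply_zero, firstDifference_windingSection, displacement_rotatingLine,
      Complex.exp_add, Complex.exp_log hr]
  · rw [hF, H.apply_one, firstDifference_windingSection, displacement_rotatingLine]
  · rw [hF, hF, rotatingLine_one]

end

theorem infinitely_many_section_homotopy_classes_R2 (n : ℕ) (hn : 2 ≤ n) :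
    ∃ s : ℕ → C(PConf n (EuclideanSpace ℝ (Fin 2)), PConf (n + 1) (EuclideanSpace ℝ (Fin 2))),
      (∀ m, ∀ x, forgetPoint n (s m x) = x) ∧
      ∀ m m', m ≠ m' → ¬ (s m).Homotopic (s m') := by
  obtain ⟨k, rfl⟩ := Nat.exists_eq_add_of_le' hn
  exact ⟨windingSection k, fun m x => rfl,
    fun m m' hne h => hne (eq_of_windingSection_homotopic h)⟩
end
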